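/- Let n, d, k be integers with 1 ≤ d ≤ ⌊(n-1)/2⌋ and k ≥ 2, and define h_k(n,x) = binomial(n-x, k) + x·binomial(x, k-1). If G is a nonhamiltonian graph on n vertices with minimum degree δ(G) ≥ d, then the number of k-cliques in G is at most max{h_k(n,d), h_k(n, ⌊(n-1)/2⌋)}. -/

import Mathlib

/-- `h_k(n,x) = C(n-x,k) + x·C(x,k-1)`. -/
def hClique (n x k : ℕ) : ℕ := (n - x).choose k + x * x.choose (k - 1)

open Finset

section Convexity

lemma le_max_of_midpoint_convex {f : ℕ → ℕ} {d m r : ℕ} (hdr : d ≤ r) (hrm : r ≤ m)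
    (hf : ∀ x, x + 2 ≤ m → 2 * f (x + 1) ≤ f x + f (x + 2)) : f r ≤ max (f d) (f m) := by
  induction m generalizing r with
  | zero => simp [show r = d by lia]
  | succ m ih =>
    obtain rfl | hrm := hrm.eq_or_lt
    · exact le_max_right _ _
    have ih' : ∀ {s}, d ≤ s → s ≤ m → f s ≤ max (f d) (f m) :=
      fun hs hsm ↦ ih hs hsm fun x hx ↦ hf x (by lia)
    have hr := ih' hdr (by lia)
    obtain rfl | hdm := (show d ≤ m by lia).eq_or_lt
    · simp_all
    obtain ⟨x, rfl⟩ : ∃ x, m = x + 1 := ⟨m - 1, by lia⟩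
    have hx := ih' (s := x) (by lia) (by lia)
    have hc := hf x le_rfl
    change f r ≤ max (f d) (f (x + 2))
    lia

lemma two_mul_hClique_succ_le {n k x : ℕ} (hk : 2 ≤ k) (hx : x + 2 ≤ n) :
    2 * hClique n (x + 1) k ≤ hClique n x k + hClique n (x + 2) k := by
  obtain ⟨j, rfl⟩ : ∃ j, k = j + 2 := ⟨k - 2, by lia⟩
  obtain ⟨N, rfl⟩ : ∃ N, n = N + x + 2 := ⟨n - x - 2, by lia⟩
  simp only [hClique, show N + x + 2 - x = N + 1 + 1 by lia,
    show N + x + 2 - (x + 1) = N + 1 by lia, show N + x + 2 - (x + 2) = N by lia,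
    show j + 2 - 1 = j + 1 by lia]
  have h₁ : N.choose (j + 1) ≤ (N + 1).choose (j + 1) := Nat.choose_mono _ (by lia)
  have h₂ : x.choose j ≤ (x + 1).choose j := Nat.choose_mono _ (by lia)
  rw [Nat.choose_succ_succ' (N + 1) (j + 1), Nat.choose_succ_succ' N (j + 1),
    Nat.choose_succ_succ' (x + 1) j, Nat.choose_succ_succ' x j]
  nlinarith [Nat.mul_le_mul_left (x + 2) h₂]

end Convexity

namespace SimpleGraph

variable {V : Type*} [Fintype V] [DecidableEq V] {G : SimpleGraph V}

lemma Walk.IsPath.isHamiltonian_of_adj {u v : V} {p : G.Walk u v} (hp : p.IsPath)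
    (hl : p.length + 1 = Fintype.card V) (hV : 3 ≤ Fintype.card V) (h : G.Adj v u) :
    G.IsHamiltonian := by
  refine fun _ ↦ ⟨v, .cons h p, ?_⟩
  rw [Walk.isHamiltonianCycle_iff_isCycle_and_length_eq,
    Walk.isCycle_iff_isPath_tail_and_le_length]
  simp_all

lemma isHamiltonian_top (hV : 3 ≤ Fintype.card V) : (⊤ : SimpleGraph V).IsHamiltonian := by
  have hnd := (univ : Finset V).nodup_toList
  have hne : (univ : Finset V).toList ≠ [] := by
    intro h
    have := congrArg List.length h
    simp at this
    lia
  have hc : (univ : Finset V).toList.IsChain (⊤ : SimpleGraph V).Adj := by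
    refine List.Pairwise.isChain (hnd.imp fun h ↦ ?_)
    simpa using h
  have hp : (Walk.ofSupport _ hne hc).IsPath := by
    rw [Walk.isPath_def, Walk.support_ofSupport]; exact hnd
  have hl : (Walk.ofSupport _ hne hc).length + 1 = Fintype.card V := by
    rw [Walk.length_ofSupport, length_toList, card_univ]; lia
  refine hp.isHamiltonian_of_adj hl hV ?_
  rw [top_adj]
  intro h
  have := Walk.length_eq_zero_iff.2 (hp.nil_iff_eq.2 h.symm)
  lia

/-- If adding the edge `uv` makes a nonhamiltonian graph Hamiltonian, then `u` and `v` are joined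
by a Hamiltonian path. -/
lemma exists_isPath_of_isHamiltonian_sup_edge {u v : V} (hV : Fintype.card V ≠ 1)
    (hG : ¬ G.IsHamiltonian) (h : (G ⊔ edge u v).IsHamiltonian) :
    ∃ p : G.Walk v u, p.IsPath ∧ p.length + 1 = Fintype.card V := by
  have key : ∀ c : (G ⊔ edge u v).Walk u u, c.IsCycle → c.length = Fintype.card V → c.snd = v →
      ∃ p : G.Walk v u, p.IsPath ∧ p.length + 1 = Fintype.card V := by
    rintro (_ | ⟨ha, p⟩) hc hl hs
    · simp at hc
    simp only [Walk.snd_cons] at hs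
    subst hs
    rw [Walk.cons_isCycle_iff] at hc
    have he : ∀ e ∈ p.edges, e ∈ G.edgeSet := by
      intro e hep
      have h1 := p.edges_subset_edgeSet hep
      rw [edgeSet_sup] at h1
      refine h1.resolve_right fun h2 ↦ hc.2 ?_
      have : e = s(u, _) := edgeSet_edge_subset h2
      exact this ▸ hep
    exact ⟨p.transfer G he, hc.1.transfer he, by simpa using hl⟩
  obtain ⟨a, c, hc⟩ := h hV
  obtain ⟨c, hc⟩ : ∃ c : (G ⊔ edge u v).Walk u u, c.IsHamiltonianCycle :=
    ⟨c.rotate u (hc.mem_support u), hc.rotate _⟩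
  have hcl := hc.length_eq
  have hcc := hc.isCycle
  have huv : s(u, v) ∈ c.edges := by
    by_contra huv
    refine hG fun _ ↦ ?_
    have he : ∀ e ∈ c.edges, e ∈ G.edgeSet := by
      intro e hec
      have h1 := c.edges_subset_edgeSet hec
      rw [edgeSet_sup] at h1
      refine h1.resolve_right fun h2 ↦ huv ?_
      have : e = s(u, v) := edgeSet_edge_subset h2
      exact this ▸ hec
    refine ⟨u, c.transfer G he, ?_⟩
    rw [Walk.isHamiltonianCycle_iff_isCycle_and_length_eq]
    exact ⟨hcc.transfer he, by simpa using hcl⟩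
  have hv : v ∈ c.toSubgraph.neighborSet u := Walk.adj_toSubgraph_iff_mem_edges.2 huv
  rw [hcc.neighborSet_toSubgraph_endpoint] at hv
  obtain hv | hv := hv
  · exact key c hcc hcl hv.symm
  · exact key c.reverse hcc.reverse (by simpa using hcl) (by simpa using hv.symm)

/-- The rotation argument of Ore: crossing chords between the ends of a Hamiltonian path and two
consecutive vertices of it produce a Hamiltonian cycle. -/
lemma Walk.IsPath.isHamiltonian_of_crossing {u v : V} {p : G.Walk u v} (hp : p.IsPath)
    (hl : p.length + 1 = Fintype.card V) (hV : 3 ≤ Fintype.card V) {i : ℕ} (hi : i < p.length)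
    (hu : G.Adj u (p.getVert (i + 1))) (hv : G.Adj v (p.getVert i)) : G.IsHamiltonian := by
  let q : G.Walk (p.getVert i) v := (p.take i).reverse.append (.cons hu (p.drop (i + 1)))
  have hq : q.length + 1 = Fintype.card V := by
    simp only [q, length_append, length_reverse, take_length, length_cons, drop_length]
    lia
  refine IsPath.isHamiltonian_of_adj (p := q) ?_ hq hV hv
  have hs : q.support.Perm p.support := by
    have h1 : q.support = (p.support.take (i + 1)).reverse ++ p.support.drop (i + 1) := by
      simp only [q, support_append, support_reverse, support_cons, List.tail_cons, support_take,
        drop_support_eq_support_drop_min]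
      rw [min_eq_left (by lia)]
    rw [h1]
    conv_rhs => rw [← List.take_append_drop (i + 1) p.support]
    exact (List.reverse_perm _).append_right _
  rw [isPath_def, hs.nodup_iff]
  exact hp.support_nodup

/-- A nonhamiltonian graph of minimum degree at least `d` has, for some `d ≤ r ≤ (n - 1) / 2`, a
set of `r` vertices of degree at most `r`. -/
lemma exists_card_eq_degree_le_of_not_isHamiltonian [DecidableRel G.Adj] {d : ℕ}
    (hV : 3 ≤ Fintype.card V) (hd : ∀ v, d ≤ G.degree v) (hG : ¬ G.IsHamiltonian) :
    ∃ r, d ≤ r ∧ r ≤ (Fintype.card V - 1) / 2 ∧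
      ∃ D : Finset V, #D = r ∧ ∀ x ∈ D, G.degree x ≤ r := by
  classical
  obtain ⟨H, hGH, hH⟩ := (Set.toFinite {H : SimpleGraph V | ¬ H.IsHamiltonian}).exists_le_maximal
    (a := G) hG
  have hne : (univ.filter fun e : V × V ↦ e.1 ≠ e.2 ∧ ¬ H.Adj e.1 e.2).Nonempty := by
    by_contra! h
    refine hH.prop ?_
    rw [show H = ⊤ from ?_]
    · exact isHamiltonian_top hV
    ext a b
    rw [top_adj]
    refine ⟨fun h ↦ h.ne, fun hab ↦ ?_⟩
    by_contra hn
    have : (a, b) ∈ (∅ : Finset (V × V)) := h ▸ by simp [hab, hn]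
    simp at this
  obtain ⟨⟨u, v⟩, he, hmax⟩ := exists_max_image _ (fun e ↦ H.degree e.1 + H.degree e.2) hne
  simp only [mem_filter, mem_univ, true_and, and_imp, Prod.forall] at he hmax
  obtain ⟨hne, hadj⟩ := he
  wlog huv : H.degree u ≤ H.degree v generalizing u v
  · exact this v u (fun a b h1 h2 ↦ by linarith [hmax a b h1 h2]) hne.symm
      (fun h ↦ hadj h.symm) (by lia)
  obtain ⟨p, hp, hl⟩ : ∃ p : H.Walk u v, p.IsPath ∧ p.length + 1 = Fintype.card V := by
    refine exists_isPath_of_isHamiltonian_sup_edge (by lia) hH.prop ?_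
    by_contra h
    refine hadj ?_
    have := hH.le_of_ge h le_sup_left
    exact this (show (H ⊔ edge v u).Adj u v by simp [sup_adj, edge_adj, hne])
  have hinj := hp.getVert_injOn
  have hsurj : ∀ x, ∃ i ≤ p.length, p.getVert i = x := by
    intro x
    have : p.IsHamiltonian := Walk.isHamiltonian_iff_isPath_and_length_eq.2 ⟨hp, by lia⟩
    obtain ⟨i, hi, hi'⟩ := Walk.mem_support_iff_exists_getVert.1 (this.mem_support x)
    exact ⟨i, hi', hi⟩
  set A := (range p.length).filter fun i ↦ H.Adj u (p.getVert (i + 1)) with hA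
  set B := (range p.length).filter fun i ↦ H.Adj v (p.getVert i) with hB
  have hAB : Disjoint A B := by
    rw [Finset.disjoint_left]
    intro i hiA hiB
    simp only [hA, hB, mem_filter, mem_range] at hiA hiB
    exact hH.prop (hp.isHamiltonian_of_crossing hl hV hiA.1 hiA.2 hiB.2)
  have hcA : H.degree u ≤ #A := by
    refine le_trans (card_le_card ?_) (card_image_le (s := A) (f := fun i ↦ p.getVert (i + 1)))
    intro x hx
    rw [mem_neighborFinset] at hx
    obtain ⟨i, hi, rfl⟩ := hsurj x
    obtain _ | i := i
    · simp at hx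
    · exact mem_image.2 ⟨i, by simp [hA, hx]; lia, rfl⟩
  have hcB : H.degree v ≤ #B := by
    refine le_trans (card_le_card ?_) (card_image_le (s := B) (f := p.getVert))
    intro x hx
    rw [mem_neighborFinset] at hx
    obtain ⟨i, hi, rfl⟩ := hsurj x
    obtain hi | rfl := hi.lt_or_eq
    · exact mem_image.2 ⟨i, by simp [hB, hx, hi], rfl⟩
    · simp at hx
  have hsum : #A + #B ≤ p.length := by
    rw [← card_union_of_disjoint hAB]
    simpa using card_le_card (union_subset (filter_subset _ _) (filter_subset _ _) :
      A ∪ B ⊆ range p.length)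
  have hcD : #(A.image p.getVert) = #A := by
    refine card_image_of_injOn (hinj.mono fun i hi ↦ ?_)
    have := (mem_filter.1 hi).1
    simp at this ⊢
    lia
  obtain ⟨D, hDA, hD⟩ := exists_subset_card_eq (hcA.trans_eq hcD.symm)
  refine ⟨H.degree u, (hd u).trans (degree_le_of_le hGH), by lia, D, hD, fun x hx ↦ ?_⟩
  refine (degree_le_of_le hGH).trans ?_
  obtain ⟨i, hi, rfl⟩ := mem_image.1 (hDA hx)
  have hi' := mem_filter.1 hi
  rw [mem_range] at hi'
  have := hmax (p.getVert i) v (fun h ↦ ?_) (fun h ↦ ?_)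
  · lia
  · have : i = p.length := hinj hi'.1.le (Set.mem_ofPred_eq ▸ le_rfl) (by simpa using h)
    lia
  · exact Finset.disjoint_left.1 hAB hi (by simp [hB, hi'.1, h.symm])

lemma card_cliqueFinset_le_of_degree_le [DecidableRel G.Adj] {k r : ℕ}
    {D : Finset V} (hD : #D = r) (hdeg : ∀ x ∈ D, G.degree x ≤ r) :
    #(G.cliqueFinset k) ≤ hClique (Fintype.card V) r k := by
  have hsub : G.cliqueFinset k ⊆ powersetCard k Dᶜ ∪
      D.biUnion fun x ↦ (powersetCard (k - 1) (G.neighborFinset x)).image (insert x) := by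
    intro s hs
    rw [mem_cliqueFinset_iff] at hs
    rw [mem_union]
    by_cases h : Disjoint s D
    · exact .inl (mem_powersetCard.2 ⟨subset_compl_iff_disjoint_right.2 h, hs.card_eq⟩)
    · obtain ⟨x, hxs, hxD⟩ := Finset.not_disjoint_iff.1 h
      refine .inr (mem_biUnion.2 ⟨x, hxD, mem_image.2 ⟨s.erase x, ?_, insert_erase hxs⟩⟩)
      rw [mem_powersetCard, card_erase_of_mem hxs, hs.card_eq]
      refine ⟨fun y hy ↦ ?_, rfl⟩
      rw [mem_erase] at hy
      rw [mem_neighborFinset]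
      exact hs.isClique hxs hy.2 hy.1.symm
  refine (card_le_card hsub).trans ((card_union_le _ _).trans ?_)
  refine Nat.add_le_add (by rw [card_powersetCard, card_compl, hD]) ?_
  rw [← hD]
  refine card_biUnion_le_card_mul _ _ _ fun x hx ↦ card_image_le.trans ?_
  rw [card_powersetCard, card_neighborFinset_eq_degree, hD]
  exact Nat.choose_mono _ (hdeg x hx)

end SimpleGraph

theorem erdos_clique_bound (n d k : ℕ) (hd1 : 1 ≤ d) (hd2 : d ≤ (n - 1) / 2)
    (hk : 2 ≤ k) (G : SimpleGraph (Fin n)) [DecidableRel G.Adj]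
    (hδ : ∀ v, d ≤ G.degree v) (hG : ¬ G.IsHamiltonian) :
    (G.cliqueFinset k).card ≤ max (hClique n d k) (hClique n ((n - 1) / 2) k) := by
  obtain ⟨r, hdr, hr, D, hD, hdeg⟩ := SimpleGraph.exists_card_eq_degree_le_of_not_isHamiltonian
    (by rw [Fintype.card_fin]; lia) hδ hG
  rw [Fintype.card_fin] at hr
  have hcard := SimpleGraph.card_cliqueFinset_le_of_degree_le (k := k) hD hdeg
  rw [Fintype.card_fin] at hcard
  exact hcard.trans (le_max_of_midpoint_convex (f := fun x ↦ hClique n x k) hdr hr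
    fun x hx ↦ two_mul_hClique_succ_le hk (by lia))
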